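/- (The biexponential problem reduces to a system of two ODEs) Biexponential case: take h(t)=e^{−δ₁t}, H(t)=e^{−δ₂t}, and U replaced by ((1−λ)/λ)·U in the time-inconsistent setup. (Necessity) Suppose σ is an equilibrium strategy whose trajectories converge to k∞, and define V(k₀) = ∫₀^∞ e^{−δ₁t}·u(σ(K_t),K_t) dt + ((1−λ)/λ)·∫₀^∞ e^{−δ₂t}·U(σ(K_t),K_t) dt and W(k₀) = ∫₀^∞ e^{−δ₁t}·u(σ(K_t),K_t) dt − ((1−λ)/λ)·∫₀^∞ e^{−δ₂t}·U(σ(K_t),K_t) dt, where K_t = K(t;k₀,σ); assume these are differentiable. Then (V,W) satisfy equations (35) and (36) with the boundary conditions (37) and (38). (Sufficiency) Conversely, suppose there are a point k∞, a C² function V and a C¹ function W on an open neighborhood of k∞ satisfying (35), (36), (37), (38), and suppose the strategy σ_λ(k):=φ_λ(V′(k),k) is convergent to k∞. Then σ_λ is an equilibrium strategy. -/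

import Mathlib

open MeasureTheory Filter Set

noncomputable def pd1 (u : ℝ → ℝ → ℝ) (c k : ℝ) : ℝ := deriv (fun x => u x k) c
noncomputable def pd2 (u : ℝ → ℝ → ℝ) (c k : ℝ) : ℝ := deriv (fun y => u c y) k
noncomputable def pd11 (u : ℝ → ℝ → ℝ) (c k : ℝ) : ℝ := deriv (fun x => pd1 u x k) c

noncomputable def Pval (u U : ℝ → ℝ → ℝ) (h H : ℝ → ℝ) (σ : ℝ → ℝ)
    (K R : ℝ → ℝ → ℝ) (k₀ c : ℝ) : ℝ :=
  u c k₀ - u (σ k₀) k₀ + (U c k₀ - U (σ k₀) k₀) +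
  ∫ t in Set.Ioi (0:ℝ),
    (h t * (pd1 u (σ (K t k₀)) (K t k₀) * deriv σ (K t k₀) + pd2 u (σ (K t k₀)) (K t k₀)) +
     H t * (pd1 U (σ (K t k₀)) (K t k₀) * deriv σ (K t k₀) + pd2 U (σ (K t k₀)) (K t k₀)))
    * (R k₀ t * (σ k₀ - c))

/-- Equation (35). -/
def Eq35 (f : ℝ → ℝ) (u U : ℝ → ℝ → ℝ) (φ : ℝ → ℝ → ℝ) (lam a b : ℝ)
    (V W : ℝ → ℝ) (k : ℝ) : Prop :=
  (f k - φ (deriv V k) k) * deriv V k + u (φ (deriv V k) k) k +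
    (1 - lam) / lam * U (φ (deriv V k) k) k = a * V k + b * W k

/-- Equation (36). -/
def Eq36 (f : ℝ → ℝ) (u U : ℝ → ℝ → ℝ) (φ : ℝ → ℝ → ℝ) (lam a b : ℝ)
    (V W : ℝ → ℝ) (k : ℝ) : Prop :=
  (f k - φ (deriv V k) k) * deriv W k + u (φ (deriv V k) k) k -
    (1 - lam) / lam * U (φ (deriv V k) k) k = b * V k + a * W k

/-- Boundary condition (37). -/
def BC37 (f : ℝ → ℝ) (u U : ℝ → ℝ → ℝ) (lam δ₁ δ₂ : ℝ) (V : ℝ → ℝ) (kinf : ℝ) : Prop :=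
  V kinf = u (f kinf) kinf / δ₁ + (1 - lam) / (lam * δ₂) * U (f kinf) kinf

/-- Boundary condition (38). -/
def BC38 (f : ℝ → ℝ) (u U : ℝ → ℝ → ℝ) (lam δ₁ δ₂ : ℝ) (W : ℝ → ℝ) (kinf : ℝ) : Prop :=
  W kinf = u (f kinf) kinf / δ₁ - (1 - lam) / (lam * δ₂) * U (f kinf) kinf

open scoped Topology

/-- A flow on the open set `N` generated by the `C¹` vector field `g`, all of whose trajectories
converge to `kinf`, together with its linearization `R`. -/
structure IsConvergentFlow (N : Set ℝ) (kinf : ℝ) (g : ℝ → ℝ) (K R : ℝ → ℝ → ℝ) : Prop where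
  isOpen : IsOpen N
  mem_limit : kinf ∈ N
  contDiffOn : ContDiffOn ℝ 1 g N
  flow_zero : ∀ k ∈ N, K 0 k = k
  hasDerivAt_flow : ∀ k ∈ N, ∀ t : ℝ, 0 ≤ t → HasDerivAt (fun s => K s k) (g (K t k)) t
  flow_mem : ∀ k ∈ N, ∀ t : ℝ, 0 ≤ t → K t k ∈ N
  tendsto_flow : ∀ k ∈ N, Tendsto (fun t => K t k) atTop (𝓝 kinf)
  lin_zero : ∀ k ∈ N, R k 0 = 1
  hasDerivAt_lin : ∀ k ∈ N, ∀ t : ℝ, 0 ≤ t → HasDerivAt (R k) (deriv g (K t k) * R k t) t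

lemma exists_abs_le_of_continuousOn_of_tendsto {F : ℝ → ℝ} {l : ℝ}
    (hF : ContinuousOn F (Ici 0)) (hl : Tendsto F atTop (𝓝 l)) :
    ∃ C, ∀ t, 0 ≤ t → |F t| ≤ C := by
  obtain ⟨T, hT⟩ := eventually_atTop.1 (hl.abs.eventually (ge_mem_nhds (lt_add_one |l|)))
  obtain ⟨C, hC⟩ := (isCompact_Icc (a := (0:ℝ)) (b := T)).exists_bound_of_continuousOn
    (hF.mono Icc_subset_Ici_self)
  refine ⟨max C (|l| + 1), fun t ht => ?_⟩
  rcases le_total t T with h | h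
  · exact le_max_of_le_left (hC t ⟨ht, h⟩)
  · exact le_max_of_le_right (hT t h)

lemma continuousOn_of_hasDerivAt_Ici {F F' : ℝ → ℝ} {a : ℝ}
    (h : ∀ t, a ≤ t → HasDerivAt F (F' t) t) : ContinuousOn F (Ici a) :=
  fun t ht => (h t ht).continuousAt.continuousWithinAt

/-- Two-sided uniqueness for a scalar linear differential equation with bounded coefficient. -/
lemma linear_ode_eq_zero {y A : ℝ → ℝ} {C T : ℝ} (hA : ∀ t, 0 ≤ t → |A t| ≤ C)
    (hy : ∀ t, 0 ≤ t → HasDerivAt y (A t * y t) t) (hT : 0 ≤ T) (hyT : y T = 0) :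
    ∀ t, 0 ≤ t → y t = 0 := by
  have hexp : ∀ c t : ℝ, 0 ≤ t → HasDerivAt (fun s => y s ^ 2 * Real.exp (c * s))
      ((2 * A t + c) * (y t ^ 2 * Real.exp (c * t))) t := by
    intro c t ht
    have h1 : HasDerivAt (fun s => Real.exp (c * s)) (Real.exp (c * t) * c) t := by
      simpa using ((hasDerivAt_id t).const_mul c).exp
    refine (((hy t ht).pow 2).mul h1).congr_deriv ?_
    simp only [Pi.pow_apply]
    push_cast
    ring
  have hmono : MonotoneOn (fun s => y s ^ 2 * Real.exp (2 * C * s)) (Ici 0) := by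
    refine monotoneOn_of_deriv_nonneg (convex_Ici 0)
      (continuousOn_of_hasDerivAt_Ici (hexp (2 * C))) ?_ ?_
    · intro t ht
      rw [interior_Ici] at ht
      exact (hexp _ t (le_of_lt ht)).differentiableAt.differentiableWithinAt
    · intro t ht
      rw [interior_Ici] at ht
      rw [(hexp _ t (le_of_lt ht)).deriv]
      have := neg_le_of_abs_le (hA t (le_of_lt ht))
      exact mul_nonneg (by linarith) (by positivity)
  have hanti : AntitoneOn (fun s => y s ^ 2 * Real.exp (-(2 * C) * s)) (Ici 0) := by
    refine antitoneOn_of_deriv_nonpos (convex_Ici 0)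
      (continuousOn_of_hasDerivAt_Ici (hexp (-(2 * C)))) ?_ ?_
    · intro t ht
      rw [interior_Ici] at ht
      exact (hexp _ t (le_of_lt ht)).differentiableAt.differentiableWithinAt
    · intro t ht
      rw [interior_Ici] at ht
      rw [(hexp _ t (le_of_lt ht)).deriv]
      have := le_of_abs_le (hA t (le_of_lt ht))
      exact mul_nonpos_of_nonpos_of_nonneg (by linarith) (by positivity)
  intro t ht
  have key : ∀ c : ℝ, y t ^ 2 * Real.exp (c * t) ≤ 0 → y t = 0 := by
    intro c h
    have h2 : y t ^ 2 ≤ 0 := by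
      by_contra! h'
      exact absurd h (not_le.2 (mul_pos h' (Real.exp_pos _)))
    exact pow_eq_zero_iff (two_ne_zero) |>.1 (le_antisymm h2 (sq_nonneg _))
  rcases le_total t T with h | h
  · exact key (2 * C) (by simpa [hyT] using hmono ht hT h)
  · exact key (-(2 * C)) (by simpa [hyT] using hanti hT ht h)

lemma integrableOn_exp_mul_of_bounded {F : ℝ → ℝ} {δ C : ℝ} (hδ : 0 < δ)
    (hF : ContinuousOn F (Ici 0)) (hC : ∀ t, 0 ≤ t → |F t| ≤ C) :
    IntegrableOn (fun t => Real.exp (-δ * t) * F t) (Ioi 0) := by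
  refine (integrableOn_exp_mul_Ioi (neg_lt_zero.2 hδ) 0).mul_bdd (c := C)
    ((hF.mono Ioi_subset_Ici_self).aestronglyMeasurable measurableSet_Ioi) ?_
  filter_upwards [ae_restrict_mem measurableSet_Ioi] with t ht
  exact hC t (le_of_lt ht)

lemma tendsto_exp_mul_of_tendsto {F : ℝ → ℝ} {δ l : ℝ} (hδ : 0 < δ)
    (hF : Tendsto F atTop (𝓝 l)) :
    Tendsto (fun t => Real.exp (-δ * t) * F t) atTop (𝓝 0) := by
  have h : Tendsto (fun t : ℝ => Real.exp (-δ * t)) atTop (𝓝 0) :=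
    Real.tendsto_exp_atBot.comp (tendsto_id.const_mul_atTop_of_neg (neg_lt_zero.2 hδ))
  simpa using h.mul hF

lemma hasDerivAt_exp_neg_mul (δ t : ℝ) :
    HasDerivAt (fun s => Real.exp (-δ * s)) (-δ * Real.exp (-δ * t)) t := by
  have := ((hasDerivAt_id t).const_mul (-δ)).exp
  refine this.congr_deriv ?_
  simp [mul_comm]

/-- At an equilibrium of `g`, a differentiable solution of `g v' + q = δ v` satisfies the
differentiated equation, even though `v'` need not be continuous there. -/
lemma deriv_eq_at_equilibrium {N : Set ℝ} {kinf δ : ℝ} {g q v : ℝ → ℝ} (hN : IsOpen N)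
    (hk : kinf ∈ N) (hg0 : g kinf = 0) (hg : DifferentiableAt ℝ g kinf)
    (hq : DifferentiableAt ℝ q kinf) (hv : DifferentiableOn ℝ v N)
    (hode : ∀ k ∈ N, g k * deriv v k + q k = δ * v k) :
    (δ - deriv g kinf) * deriv v kinf = deriv q kinf := by
  obtain ⟨ε, hε, hball⟩ := Metric.isOpen_iff.1 hN kinf hk
  have hsub : ∀ x ∈ Ioo kinf (kinf + ε), Icc kinf x ⊆ N := by
    intro x hx z hz
    refine hball ?_
    rw [Metric.mem_ball, Real.dist_eq, abs_lt]
    constructor <;> linarith [hx.2, hz.1, hz.2]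
  have hmv : ∀ x, ∃ ξ, x ∈ Ioo kinf (kinf + ε) → ξ ∈ Ioo kinf x ∧ deriv v ξ = slope v kinf x := by
    intro x
    by_cases hx : x ∈ Ioo kinf (kinf + ε)
    · obtain ⟨ξ, h1, h2⟩ := exists_deriv_eq_slope' v hx.1 (hv.continuousOn.mono (hsub x hx))
        (hv.mono (Ioo_subset_Icc_self.trans (hsub x hx)))
      exact ⟨ξ, fun _ => ⟨h1, h2⟩⟩
    · exact ⟨0, fun h => absurd h hx⟩
  choose ξ hξ using hmv
  have hev : ∀ᶠ x in 𝓝[>] kinf, x ∈ Ioo kinf (kinf + ε) :=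
    Ioo_mem_nhdsGT (by linarith)
  have hξt : Tendsto ξ (𝓝[>] kinf) (𝓝[>] kinf) := by
    refine tendsto_nhdsWithin_iff.2 ⟨?_, ?_⟩
    · refine tendsto_of_tendsto_of_tendsto_of_le_of_le' tendsto_const_nhds
        (tendsto_id.mono_left nhdsWithin_le_nhds) ?_ ?_
      · filter_upwards [hev] with x hx using (hξ x hx).1.1.le
      · filter_upwards [hev] with x hx using (hξ x hx).1.2.le
    · filter_upwards [hev] with x hx using (hξ x hx).1.1
  have hslope : ∀ {w : ℝ → ℝ}, DifferentiableAt ℝ w kinf →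
      Tendsto (slope w kinf) (𝓝[>] kinf) (𝓝 (deriv w kinf)) := fun hw =>
    (hasDerivAt_iff_tendsto_slope.1 hw.hasDerivAt).mono_left
      (nhdsWithin_mono _ fun x hx => ne_of_gt hx)
  have hvk : DifferentiableAt ℝ v kinf := hv.differentiableAt (hN.mem_nhds hk)
  have hlim1 : Tendsto (fun x => δ * slope v kinf (ξ x)) (𝓝[>] kinf) (𝓝 (δ * deriv v kinf)) :=
    ((hslope hvk).comp hξt).const_mul δ
  have hlim2 : Tendsto (fun x => slope g kinf (ξ x) * slope v kinf x + slope q kinf (ξ x))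
      (𝓝[>] kinf) (𝓝 (deriv g kinf * deriv v kinf + deriv q kinf)) :=
    (((hslope hg).comp hξt).mul (hslope hvk)).add ((hslope hq).comp hξt)
  have heq : δ * deriv v kinf = deriv g kinf * deriv v kinf + deriv q kinf := by
    refine tendsto_nhds_unique hlim1 (hlim2.congr' ?_)
    filter_upwards [hev] with x hx
    obtain ⟨h1, h2⟩ := hξ x hx
    rw [← h2, slope_def_field, slope_def_field, slope_def_field]
    have e1 := hode _ (hsub x hx ⟨h1.1.le, h1.2.le⟩)
    have e2 := hode _ hk
    rw [hg0] at e2 ⊢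
    have hne : ξ x - kinf ≠ 0 := sub_ne_zero.2 (ne_of_gt h1.1)
    field_simp
    linarith
  linarith

namespace IsConvergentFlow

variable {N : Set ℝ} {kinf : ℝ} {g : ℝ → ℝ} {K R : ℝ → ℝ → ℝ}

lemma continuousOn_flow (hF : IsConvergentFlow N kinf g K R) {k : ℝ} (hk : k ∈ N) :
    ContinuousOn (fun t => K t k) (Ici 0) :=
  continuousOn_of_hasDerivAt_Ici (hF.hasDerivAt_flow k hk)

lemma continuousOn_comp (hF : IsConvergentFlow N kinf g K R) {k : ℝ} (hk : k ∈ N) {w : ℝ → ℝ}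
    (hw : ContinuousOn w N) : ContinuousOn (fun t => w (K t k)) (Ici 0) :=
  hw.comp (hF.continuousOn_flow hk) fun t ht => hF.flow_mem k hk t ht

lemma tendsto_comp (hF : IsConvergentFlow N kinf g K R) {k : ℝ} (hk : k ∈ N) {w : ℝ → ℝ}
    (hw : ContinuousOn w N) : Tendsto (fun t => w (K t k)) atTop (𝓝 (w kinf)) :=
  (hw.continuousAt (hF.isOpen.mem_nhds hF.mem_limit)).tendsto.comp (hF.tendsto_flow k hk)

lemma exists_bound_comp (hF : IsConvergentFlow N kinf g K R) {k : ℝ} (hk : k ∈ N) {w : ℝ → ℝ}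
    (hw : ContinuousOn w N) : ∃ C, ∀ t, 0 ≤ t → |w (K t k)| ≤ C :=
  exists_abs_le_of_continuousOn_of_tendsto (hF.continuousOn_comp hk hw) (hF.tendsto_comp hk hw)

lemma differentiableAt (hF : IsConvergentFlow N kinf g K R) {k : ℝ} (hk : k ∈ N) :
    DifferentiableAt ℝ g k :=
  (hF.contDiffOn.differentiableOn one_ne_zero).differentiableAt (hF.isOpen.mem_nhds hk)

lemma continuousOn_deriv (hF : IsConvergentFlow N kinf g K R) : ContinuousOn (deriv g) N :=
  hF.contDiffOn.continuousOn_deriv_of_isOpen hF.isOpen le_rfl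

lemma hasDerivAt_comp (hF : IsConvergentFlow N kinf g K R) {k t : ℝ} (hk : k ∈ N) (ht : 0 ≤ t)
    {w : ℝ → ℝ} (hw : DifferentiableOn ℝ w N) :
    HasDerivAt (fun s => w (K s k)) (deriv w (K t k) * g (K t k)) t :=
  HasDerivAt.comp t (h₂ := w)
    (hw.differentiableAt (hF.isOpen.mem_nhds (hF.flow_mem k hk t ht))).hasDerivAt
    (hF.hasDerivAt_flow k hk t ht)

lemma eq_lin_mul (hF : IsConvergentFlow N kinf g K R) {k : ℝ} (hk : k ∈ N) {y : ℝ → ℝ}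
    (hy : ∀ t, 0 ≤ t → HasDerivAt y (deriv g (K t k) * y t) t) {t : ℝ} (ht : 0 ≤ t) :
    y t = y 0 * R k t := by
  obtain ⟨C, hC⟩ := hF.exists_bound_comp hk hF.continuousOn_deriv
  have := linear_ode_eq_zero (y := fun t => y t - y 0 * R k t) hC
    (fun t ht => ((hy t ht).sub ((hF.hasDerivAt_lin k hk t ht).const_mul (y 0))).congr_deriv
      (by ring)) le_rfl (by simp [hF.lin_zero k hk]) t ht
  linarith

lemma hasDerivAt_velocity (hF : IsConvergentFlow N kinf g K R) {k t : ℝ} (hk : k ∈ N)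
    (ht : 0 ≤ t) :
    HasDerivAt (fun s => g (K s k)) (deriv g (K t k) * g (K t k)) t :=
  hF.hasDerivAt_comp hk ht (hF.contDiffOn.differentiableOn one_ne_zero)

lemma velocity_eq (hF : IsConvergentFlow N kinf g K R) {k t : ℝ} (hk : k ∈ N) (ht : 0 ≤ t) :
    g (K t k) = g k * R k t := by
  have := hF.eq_lin_mul hk (y := fun s => g (K s k)) (fun t ht => hF.hasDerivAt_velocity hk ht) ht
  simpa [hF.flow_zero k hk] using this

lemma velocity_limit_eq_zero (hF : IsConvergentFlow N kinf g K R) : g kinf = 0 := by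
  have hk := hF.mem_limit
  have hmv : ∀ t : ℝ, ∃ ξ, 0 ≤ t → t ≤ ξ ∧ g (K ξ kinf) = K (t + 1) kinf - K t kinf := by
    intro t
    by_cases ht : 0 ≤ t
    · obtain ⟨ξ, h1, h2⟩ := exists_hasDerivAt_eq_slope (fun s => K s kinf)
        (fun s => g (K s kinf)) (lt_add_one t)
        ((hF.continuousOn_flow hk).mono fun s hs => ht.trans hs.1)
        (fun s hs => hF.hasDerivAt_flow kinf hk s (ht.trans hs.1.le))
      refine ⟨ξ, fun _ => ⟨h1.1.le, ?_⟩⟩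
      simpa using h2
    · exact ⟨0, fun h => absurd h ht⟩
  choose ξ hξ using hmv
  have hξt : Tendsto ξ atTop atTop := tendsto_atTop_mono' _
    (by filter_upwards [eventually_ge_atTop 0] with t ht using (hξ t ht).1) tendsto_id
  have h1 := (hF.tendsto_comp hk hF.contDiffOn.continuousOn).comp hξt
  have h2 : Tendsto (fun t => K (t + 1) kinf - K t kinf) atTop (𝓝 (kinf - kinf)) :=
    ((hF.tendsto_flow kinf hk).comp (tendsto_atTop_add_const_right _ 1 tendsto_id)).sub
      (hF.tendsto_flow kinf hk)
  rw [sub_self] at h2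
  refine tendsto_nhds_unique h1 (h2.congr' ?_)
  filter_upwards [eventually_ge_atTop 0] with t ht using (hξ t ht).2.symm

lemma flow_eq_of_velocity_eq_zero (hF : IsConvergentFlow N kinf g K R) {k t : ℝ} (hk : k ∈ N)
    (hgk : g k = 0) (ht : 0 ≤ t) : K t k = k := by
  have h := constant_of_has_deriv_right_zero (f := fun s => K s k) (a := 0) (b := t)
    ((hF.continuousOn_flow hk).mono Icc_subset_Ici_self) (fun s hs => by
      have := hF.hasDerivAt_flow k hk s hs.1
      rw [hF.velocity_eq hk hs.1, hgk, zero_mul] at this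
      exact this.hasDerivWithinAt) t ⟨ht, le_rfl⟩
  simpa [hF.flow_zero k hk] using h

lemma eq_limit_of_velocity_eq_zero (hF : IsConvergentFlow N kinf g K R) {k : ℝ} (hk : k ∈ N)
    (hgk : g k = 0) : k = kinf := by
  refine tendsto_nhds_unique (tendsto_const_nhds.congr' ?_) (hF.tendsto_flow k hk)
  filter_upwards [eventually_ge_atTop 0] with t ht
  exact (hF.flow_eq_of_velocity_eq_zero hk hgk ht).symm

lemma deriv_velocity_limit_nonpos (hF : IsConvergentFlow N kinf g K R) : deriv g kinf ≤ 0 := by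
  by_contra! hpos
  obtain ⟨k, hk, hne⟩ : ∃ k ∈ N, k ≠ kinf := by
    have h1 : ∀ᶠ k in 𝓝[≠] kinf, k ∈ N :=
      nhdsWithin_le_nhds (hF.isOpen.mem_nhds hF.mem_limit)
    have h2 : ∀ᶠ k in 𝓝[≠] kinf, k ≠ kinf := self_mem_nhdsWithin
    exact (h1.and h2).exists
  obtain ⟨T, hT⟩ := eventually_atTop.1
    ((hF.tendsto_comp hk hF.continuousOn_deriv).eventually (lt_mem_nhds hpos))
  set S := max T 0
  have hS : 0 ≤ S := le_max_right _ _
  have hd : ∀ t, S ≤ t → HasDerivAt (fun s => g (K s k) ^ 2)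
      (2 * deriv g (K t k) * g (K t k) ^ 2) t := fun t ht =>
    ((hF.hasDerivAt_velocity hk (hS.trans ht)).pow 2).congr_deriv (by push_cast; ring)
  have hmono : MonotoneOn (fun s => g (K s k) ^ 2) (Ici S) := by
    refine monotoneOn_of_deriv_nonneg (convex_Ici S) (continuousOn_of_hasDerivAt_Ici hd) ?_ ?_
    · intro t ht
      rw [interior_Ici] at ht
      exact (hd t (le_of_lt ht)).differentiableAt.differentiableWithinAt
    · intro t ht
      rw [interior_Ici] at ht
      rw [(hd t (le_of_lt ht)).deriv]
      have := hT t ((le_max_left _ _).trans (le_of_lt ht))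
      positivity
  have hlim : Tendsto (fun s => g (K s k) ^ 2) atTop (𝓝 0) := by
    have := (hF.tendsto_comp hk hF.contDiffOn.continuousOn).pow 2
    simpa [hF.velocity_limit_eq_zero] using this
  have hle : g (K S k) ^ 2 ≤ 0 := by
    refine ge_of_tendsto hlim ?_
    filter_upwards [eventually_ge_atTop S] with t ht using hmono self_mem_Ici ht ht
  have hzero : g (K S k) = 0 :=
    pow_eq_zero_iff two_ne_zero |>.1 (le_antisymm hle (sq_nonneg _))
  obtain ⟨C, hC⟩ := hF.exists_bound_comp hk hF.continuousOn_deriv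
  have := linear_ode_eq_zero (y := fun s => g (K s k)) hC
    (fun t ht => hF.hasDerivAt_velocity hk ht) hS hzero 0 le_rfl
  rw [hF.flow_zero k hk] at this
  exact hne (hF.eq_limit_of_velocity_eq_zero hk this)

lemma lin_limit_eq (hF : IsConvergentFlow N kinf g K R) {t : ℝ} (ht : 0 ≤ t) :
    R kinf t = Real.exp (deriv g kinf * t) := by
  have hk := hF.mem_limit
  have h := hF.eq_lin_mul hk (y := fun s => Real.exp (deriv g kinf * s)) (fun s hs => by
    rw [hF.flow_eq_of_velocity_eq_zero hk hF.velocity_limit_eq_zero hs]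
    simpa using hasDerivAt_exp_neg_mul (-deriv g kinf) s) ht
  simpa using h.symm

/-- The discounted marginal value along a trajectory is the derivative of the value function. -/
lemma integral_marginal_eq (hF : IsConvergentFlow N kinf g K R) {q v : ℝ → ℝ} {δ : ℝ} (hδ : 0 < δ)
    (hq : ContDiffOn ℝ 1 q N) (hv : DifferentiableOn ℝ v N)
    (hode : ∀ k ∈ N, g k * deriv v k + q k = δ * v k) {k : ℝ} (hk : k ∈ N) :
    IntegrableOn (fun t => Real.exp (-δ * t) * (deriv q (K t k) * R k t)) (Ioi 0) ∧
      ∫ t in Ioi (0:ℝ), Real.exp (-δ * t) * (deriv q (K t k) * R k t) = deriv v k := by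
  have hqd : DifferentiableOn ℝ q N := hq.differentiableOn one_ne_zero
  have hq' : ContinuousOn (deriv q) N := hq.continuousOn_deriv_of_isOpen hF.isOpen le_rfl
  by_cases hkk : k = kinf
  · subst hkk
    have hγ := hF.deriv_velocity_limit_nonpos
    have heq : EqOn (fun t => Real.exp ((deriv g k - δ) * t) * deriv q k)
        (fun t => Real.exp (-δ * t) * (deriv q (K t k) * R k t)) (Ioi 0) := by
      intro t ht
      have ht' : 0 ≤ t := le_of_lt ht
      simp only
      rw [hF.flow_eq_of_velocity_eq_zero hk hF.velocity_limit_eq_zero ht', hF.lin_limit_eq ht',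
        mul_left_comm, ← Real.exp_add, mul_comm]
      ring_nf
    have hneg : deriv g k - δ < 0 := by linarith
    refine ⟨IntegrableOn.congr_fun ((integrableOn_exp_mul_Ioi hneg 0).mul_const _) heq
      measurableSet_Ioi, ?_⟩
    rw [← setIntegral_congr_fun measurableSet_Ioi heq, integral_mul_const,
      integral_exp_mul_Ioi hneg]
    have := deriv_eq_at_equilibrium hF.isOpen hk hF.velocity_limit_eq_zero
      (hF.differentiableAt hk) (hqd.differentiableAt (hF.isOpen.mem_nhds hk)) hv hode
    rw [← this]
    have : deriv g k - δ ≠ 0 := hneg.ne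
    simp only [mul_zero, Real.exp_zero]
    field_simp
    ring
  · have hgk : g k ≠ 0 := fun h => hkk (hF.eq_limit_of_velocity_eq_zero hk h)
    have hqg : ContinuousOn (fun x => deriv q x * g x) N := hq'.mul hF.contDiffOn.continuousOn
    obtain ⟨C, hC⟩ := hF.exists_bound_comp hk hqg
    have hint := integrableOn_exp_mul_of_bounded hδ (hF.continuousOn_comp hk hqg) hC
    have hderiv : ∀ t ∈ Ici (0:ℝ), HasDerivAt
        (fun s => Real.exp (-δ * s) * (q (K s k) - δ * v (K s k)))
        (Real.exp (-δ * t) * (deriv q (K t k) * g (K t k))) t := by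
      intro t ht
      refine ((hasDerivAt_exp_neg_mul δ t).mul ((hF.hasDerivAt_comp hk ht hqd).sub
        ((hF.hasDerivAt_comp hk ht hv).const_mul δ))).congr_deriv ?_
      simp only [Pi.sub_apply]
      linear_combination (-δ * Real.exp (-δ * t)) * hode _ (hF.flow_mem k hk t ht)
    have hval := integral_Ioi_of_hasDerivAt_of_tendsto' hderiv hint
      (tendsto_exp_mul_of_tendsto hδ (hF.tendsto_comp hk
        (hq.continuousOn.sub (hv.continuousOn.const_mul δ))))
    have heq : EqOn (fun t => (Real.exp (-δ * t) * (deriv q (K t k) * g (K t k))) * (g k)⁻¹)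
        (fun t => Real.exp (-δ * t) * (deriv q (K t k) * R k t)) (Ioi 0) := by
      intro t ht
      simp only
      rw [hF.velocity_eq hk (le_of_lt ht)]
      field_simp
    refine ⟨IntegrableOn.congr_fun (hint.mul_const _) heq measurableSet_Ioi, ?_⟩
    rw [← setIntegral_congr_fun measurableSet_Ioi heq, integral_mul_const, hval,
      hF.flow_zero k hk]
    have := hode k hk
    simp only [mul_zero, Real.exp_zero]
    field_simp
    linarith

lemma flow_add (hF : IsConvergentFlow N kinf g K R) {k s t : ℝ} (hk : k ∈ N) (hs : 0 ≤ s)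
    (ht : 0 ≤ t) : K t (K s k) = K (t + s) k := by
  have hks := hF.flow_mem k hk s hs
  have hcX : ContinuousOn (fun r => K r (K s k)) (Icc 0 t) :=
    (hF.continuousOn_flow hks).mono Icc_subset_Ici_self
  have hcY : ContinuousOn (fun r => K (r + s) k) (Icc 0 t) :=
    (hF.continuousOn_flow hk).comp (by fun_prop) fun r hr => add_nonneg hr.1 hs
  set S : Set ℝ := (fun r => K r (K s k)) '' Icc 0 t ∪ (fun r => K (r + s) k) '' Icc 0 t
  have hSN : S ⊆ N := by
    rintro _ (⟨r, hr, rfl⟩ | ⟨r, hr, rfl⟩)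
    · exact hF.flow_mem _ hks r hr.1
    · exact hF.flow_mem _ hk _ (add_nonneg hr.1 hs)
  have hScomp : IsCompact S :=
    (isCompact_Icc.image_of_continuousOn hcX).union (isCompact_Icc.image_of_continuousOn hcY)
  have hloc : LocallyLipschitzOn S g := by
    intro x hx
    obtain ⟨L, V, hV, hL⟩ := (hF.contDiffOn.contDiffAt
      (hF.isOpen.mem_nhds (hSN hx))).exists_lipschitzOnWith
    exact ⟨L, V, nhdsWithin_le_nhds hV, hL⟩
  obtain ⟨L, hL⟩ := hloc.exists_lipschitzOnWith_of_compact hScomp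
  refine ODE_solution_unique_of_mem_Icc_right (v := fun _ => g) (s := fun _ => S) (K := L)
    (f := fun r => K r (K s k)) (g := fun r => K (r + s) k) (a := 0) (b := t)
    (fun _ _ => hL) hcX ?_ ?_ hcY ?_ ?_ ?_ ⟨ht, le_rfl⟩
  · exact fun r hr => (hF.hasDerivAt_flow _ hks r hr.1).hasDerivWithinAt
  · exact fun r hr => Or.inl ⟨r, Ico_subset_Icc_self hr, rfl⟩
  · intro r hr
    have := hF.hasDerivAt_flow k hk (r + s) (add_nonneg hr.1 hs)
    exact (this.comp_add_const r s).hasDerivWithinAt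
  · exact fun r hr => Or.inr ⟨r, Ico_subset_Icc_self hr, rfl⟩
  · simp [hF.flow_zero _ hks]

/-- A differentiable discounted integral along the flow solves its linear transport equation. -/
lemma transport_eq_of_integral (hF : IsConvergentFlow N kinf g K R) {q v : ℝ → ℝ} {δ : ℝ}
    (hδ : 0 < δ) (hq : ContinuousOn q N) (hv : DifferentiableOn ℝ v N)
    (hint : ∀ k ∈ N, v k = ∫ t in Ioi (0:ℝ), Real.exp (-δ * t) * q (K t k)) {k : ℝ} (hk : k ∈ N) :
    g k * deriv v k + q k = δ * v k := by
  set F : ℝ → ℝ := fun r => Real.exp (-δ * r) * q (K (max r 0) k) with hFdef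
  have hFc : Continuous F := by
    refine (by fun_prop : Continuous fun r : ℝ => Real.exp (-δ * r)).mul ?_
    exact (hF.continuousOn_comp hk hq).comp_continuous (f := fun r : ℝ => max r 0)
      (by fun_prop) fun r => mem_Ici.2 (le_max_right _ _)
  have hFeq : ∀ r, 0 ≤ r → F r = Real.exp (-δ * r) * q (K r k) := fun r hr => by
    simp only [hFdef, max_eq_left hr]
  obtain ⟨C, hC⟩ := hF.exists_bound_comp hk hq
  have hFint : IntegrableOn F (Ioi 0) :=
    (integrableOn_exp_mul_of_bounded hδ (hF.continuousOn_comp hk hq) hC).congr_fun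
      (fun r hr => (hFeq r (le_of_lt hr)).symm) measurableSet_Ioi
  have hv0 : v k = ∫ r in Ioi 0, F r := by
    rw [hint k hk]
    exact setIntegral_congr_fun measurableSet_Ioi fun r hr => (hFeq r (le_of_lt hr)).symm
  have hshift : ∀ s, 0 ≤ s → v (K s k) = Real.exp (δ * s) * (v k - ∫ r in (0:ℝ)..s, F r) := by
    intro s hs
    have h1 : v k - ∫ r in (0:ℝ)..s, F r = ∫ r in Ioi s, F r := by
      rw [hv0, ← intervalIntegral.integral_interval_add_Ioi hFint
        (hFint.mono_set (Ioi_subset_Ioi hs))]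
      ring
    have h2 : ∫ r in Ioi s, F r = ∫ r in Ioi (0:ℝ), F (r + s) := by
      have := (measurePreserving_add_right (volume : Measure ℝ) s).setIntegral_preimage_emb
        (measurableEmbedding_addRight s) F (Ioi s)
      rw [preimage_add_const_Ioi, sub_self] at this
      exact this.symm
    rw [h1, h2, hint _ (hF.flow_mem k hk s hs), ← integral_const_mul]
    refine setIntegral_congr_fun measurableSet_Ioi fun r hr => ?_
    have hr' : 0 ≤ r := le_of_lt hr
    rw [hFeq _ (add_nonneg hr' hs), hF.flow_add hk hs hr', ← mul_assoc, ← Real.exp_add]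
    ring_nf
  have hd1 : HasDerivWithinAt (fun s => v (K s k)) (deriv v k * g k) (Ici 0) 0 := by
    have := hF.hasDerivAt_comp hk le_rfl hv
    rw [hF.flow_zero k hk] at this
    exact this.hasDerivWithinAt
  have hd2 : HasDerivWithinAt (fun s => v (K s k)) (δ * v k - q k) (Ici 0) 0 := by
    have hI : HasDerivAt (fun s => ∫ r in (0:ℝ)..s, F r) (F 0) 0 :=
      (hFc.integral_hasStrictDerivAt 0 0).hasDerivAt
    have hE : HasDerivAt (fun s => Real.exp (δ * s)) (δ * Real.exp (δ * 0)) 0 := by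
      simpa using hasDerivAt_exp_neg_mul (-δ) 0
    have hprod := (hE.mul (hI.const_sub (v k))).hasDerivWithinAt (s := Ici 0)
    refine (hprod.congr_of_mem (fun s hs => hshift s hs) self_mem_Ici).congr_deriv ?_
    simp [hFeq, hF.flow_zero k hk]
    ring
  have := (uniqueDiffOn_Ici (0:ℝ) 0 self_mem_Ici).eq_deriv _ hd1 hd2
  linarith

end IsConvergentFlow

section Utility

variable {u U : ℝ → ℝ → ℝ}

lemma hasDerivAt_pd1 (hu : ContDiffOn ℝ 1 (fun p : ℝ × ℝ => u p.1 p.2) (Ioi 0 ×ˢ Ioi 0))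
    {c k : ℝ} (hc : 0 < c) (hk : 0 < k) : HasDerivAt (fun x => u x k) (pd1 u c k) c := by
  have h : DifferentiableAt ℝ (fun p : ℝ × ℝ => u p.1 p.2) (c, k) :=
    (hu.differentiableOn one_ne_zero).differentiableAt
      ((isOpen_Ioi.prod isOpen_Ioi).mem_nhds ⟨hc, hk⟩)
  have h2 : DifferentiableAt ℝ (fun x : ℝ => (x, k)) c := by fun_prop
  exact (DifferentiableAt.comp (g := fun p : ℝ × ℝ => u p.1 p.2) c h h2).hasDerivAt

lemma contDiffOn_along (hu : ContDiffOn ℝ 1 (fun p : ℝ × ℝ => u p.1 p.2) (Ioi 0 ×ˢ Ioi 0))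
    {N : Set ℝ} {σ : ℝ → ℝ} (hN0 : N ⊆ Ioi 0) (hσ : ContDiffOn ℝ 1 σ N)
    (hpos : ∀ k ∈ N, 0 < σ k) : ContDiffOn ℝ 1 (fun k => u (σ k) k) N :=
  hu.comp (hσ.prodMk contDiffOn_id) fun k hk => ⟨hpos k hk, hN0 hk⟩

lemma deriv_along (hu : ContDiffOn ℝ 1 (fun p : ℝ × ℝ => u p.1 p.2) (Ioi 0 ×ˢ Ioi 0))
    {σ : ℝ → ℝ} {k : ℝ} (hk : 0 < k) (hσ : DifferentiableAt ℝ σ k) (hpos : 0 < σ k) :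
    deriv (fun k => u (σ k) k) k = pd1 u (σ k) k * deriv σ k + pd2 u (σ k) k := by
  have hmem : (σ k, k) ∈ Ioi (0:ℝ) ×ˢ Ioi (0:ℝ) := ⟨hpos, hk⟩
  have h : HasFDerivAt (fun p : ℝ × ℝ => u p.1 p.2) _ (σ k, k) :=
    ((hu.differentiableOn one_ne_zero).differentiableAt
      ((isOpen_Ioi.prod isOpen_Ioi).mem_nhds hmem)).hasFDerivAt
  have h1 : HasDerivAt (fun x => u x k) _ (σ k) :=
    HasFDerivAt.comp_hasDerivAt (l := fun p : ℝ × ℝ => u p.1 p.2) (f := fun x : ℝ => (x, k))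
      (σ k) h ((hasDerivAt_id (σ k)).prodMk (hasDerivAt_const _ k))
  have h2 : HasDerivAt (fun y => u (σ k) y) _ k :=
    HasFDerivAt.comp_hasDerivAt (l := fun p : ℝ × ℝ => u p.1 p.2) (f := fun y : ℝ => (σ k, y))
      k h ((hasDerivAt_const k (σ k)).prodMk (hasDerivAt_id k))
  have h3 : HasDerivAt (fun y => u (σ y) y) _ k :=
    HasFDerivAt.comp_hasDerivAt (l := fun p : ℝ × ℝ => u p.1 p.2) (f := fun y : ℝ => (σ y, y))
      k h (hσ.hasDerivAt.prodMk (hasDerivAt_id k))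
  rw [pd1, pd2, h1.deriv, h2.deriv, h3.deriv]
  have : ((deriv σ k, 1) : ℝ × ℝ) = deriv σ k • ((1, 0) : ℝ × ℝ) + (0, 1) := by simp
  rw [this, map_add, map_smul, smul_eq_mul, mul_comm]

lemma strictAntiOn_pd1 {k : ℝ} (h : ∀ c > (0:ℝ), pd11 u c k < 0) :
    StrictAntiOn (fun c => pd1 u c k) (Ioi 0) := by
  refine strictAntiOn_of_deriv_neg (convex_Ioi 0) (fun c hc => ?_) fun c hc => ?_
  · exact (differentiableAt_of_deriv_ne_zero (h c hc).ne).continuousAt.continuousWithinAt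
  · rw [interior_Ioi] at hc
    exact h c hc

lemma pd1_pos {k c : ℝ} (hmono : StrictMonoOn (fun c => u c k) (Ioi 0))
    (hanti : StrictAntiOn (fun c => pd1 u c k) (Ioi 0)) (hc : 0 < c) : 0 < pd1 u c k := by
  have hc1 : 0 < c + 1 := by linarith
  refine lt_of_le_of_lt ?_ (hanti hc hc1 (lt_add_one c))
  change 0 ≤ deriv (fun x => u x k) (c + 1)
  rw [← derivWithin_of_mem_nhds (Ioi_mem_nhds hc1)]
  exact hmono.monotoneOn.derivWithin_nonneg

lemma pd1_const_mul (κ c k : ℝ) : pd1 (fun x y => κ * U x y) c k = κ * pd1 U c k :=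
  deriv_const_mul_field _

lemma pd11_const_mul (κ c k : ℝ) : pd11 (fun x y => κ * U x y) c k = κ * pd11 U c k := by
  simp only [pd11, pd1_const_mul]
  exact deriv_const_mul_field _

/-- A function on the half-line with decreasing derivative lies below its tangents. -/
lemma le_tangent_of_antitoneOn_deriv {G G' : ℝ → ℝ} (hG : ∀ c > (0:ℝ), HasDerivAt G (G' c) c)
    (hanti : AntitoneOn G' (Ioi 0)) {s c : ℝ} (hs : 0 < s) (hc : 0 < c) :
    G c - G s ≤ G' s * (c - s) := by
  have hcont : ContinuousOn G (Ioi 0) := fun x hx => (hG x hx).continuousAt.continuousWithinAt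
  rcases lt_trichotomy s c with h | rfl | h
  · obtain ⟨ξ, hξ, he⟩ := exists_hasDerivAt_eq_slope G G' h
      (hcont.mono fun x hx => hs.trans_le hx.1) fun x hx => hG x (hs.trans hx.1)
    have := hanti hs (hs.trans hξ.1) hξ.1.le
    rw [he, div_le_iff₀ (sub_pos.2 h)] at this
    exact this
  · simp
  · obtain ⟨ξ, hξ, he⟩ := exists_hasDerivAt_eq_slope G G' h
      (hcont.mono fun x hx => hc.trans_le hx.1) fun x hx => hG x (hc.trans hx.1)
    have := hanti (hc.trans hξ.1) hs hξ.2.le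
    rw [he, le_div_iff₀ (sub_pos.2 h)] at this
    linarith

end Utility

lemma Pval_eq {N : Set ℝ} {kinf δ₁ δ₂ : ℝ} {g σ v₁ v₂ : ℝ → ℝ} {K R u U : ℝ → ℝ → ℝ}
    (hF : IsConvergentFlow N kinf g K R) (hN0 : N ⊆ Ioi 0)
    (hu : ContDiffOn ℝ 1 (fun p : ℝ × ℝ => u p.1 p.2) (Ioi 0 ×ˢ Ioi 0))
    (hU : ContDiffOn ℝ 1 (fun p : ℝ × ℝ => U p.1 p.2) (Ioi 0 ×ˢ Ioi 0))
    (hσ : ContDiffOn ℝ 1 σ N) (hpos : ∀ k ∈ N, 0 < σ k) (hδ₁ : 0 < δ₁) (hδ₂ : 0 < δ₂)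
    (hv₁ : DifferentiableOn ℝ v₁ N) (hv₂ : DifferentiableOn ℝ v₂ N)
    (hode₁ : ∀ k ∈ N, g k * deriv v₁ k + u (σ k) k = δ₁ * v₁ k)
    (hode₂ : ∀ k ∈ N, g k * deriv v₂ k + U (σ k) k = δ₂ * v₂ k) {k : ℝ} (hk : k ∈ N) (c : ℝ) :
    Pval u U (fun t => Real.exp (-δ₁ * t)) (fun t => Real.exp (-δ₂ * t)) σ K R k c =
      u c k - u (σ k) k + (U c k - U (σ k) k) + (deriv v₁ k + deriv v₂ k) * (σ k - c) := by
  obtain ⟨hi₁, he₁⟩ := hF.integral_marginal_eq hδ₁ (contDiffOn_along hu hN0 hσ hpos) hv₁ hode₁ hk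
  obtain ⟨hi₂, he₂⟩ := hF.integral_marginal_eq hδ₂ (contDiffOn_along hU hN0 hσ hpos) hv₂ hode₂ hk
  rw [Pval, ← he₁, ← he₂, ← integral_add hi₁ hi₂, ← integral_mul_const]
  congr 1
  refine setIntegral_congr_fun measurableSet_Ioi fun t ht => ?_
  have hKN := hF.flow_mem k hk t (le_of_lt ht)
  have hσd : DifferentiableAt ℝ σ (K t k) :=
    (hσ.differentiableOn one_ne_zero).differentiableAt (hF.isOpen.mem_nhds hKN)
  rw [deriv_along hu (hN0 hKN) hσd (hpos _ hKN), deriv_along hU (hN0 hKN) hσd (hpos _ hKN)]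
  ring

/-- The equilibrium condition is the first order condition equating the marginal utility of
consumption with the marginal value of capital. -/
lemma forall_Pval_le_iff {N : Set ℝ} {kinf δ₁ δ₂ : ℝ} {g σ v₁ v₂ : ℝ → ℝ} {K R u U : ℝ → ℝ → ℝ}
    (hF : IsConvergentFlow N kinf g K R) (hN0 : N ⊆ Ioi 0)
    (hu : ContDiffOn ℝ 1 (fun p : ℝ × ℝ => u p.1 p.2) (Ioi 0 ×ˢ Ioi 0))
    (hU : ContDiffOn ℝ 1 (fun p : ℝ × ℝ => U p.1 p.2) (Ioi 0 ×ˢ Ioi 0))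
    (hσ : ContDiffOn ℝ 1 σ N) (hpos : ∀ k ∈ N, 0 < σ k) (hδ₁ : 0 < δ₁) (hδ₂ : 0 < δ₂)
    (hv₁ : DifferentiableOn ℝ v₁ N) (hv₂ : DifferentiableOn ℝ v₂ N)
    (hode₁ : ∀ k ∈ N, g k * deriv v₁ k + u (σ k) k = δ₁ * v₁ k)
    (hode₂ : ∀ k ∈ N, g k * deriv v₂ k + U (σ k) k = δ₂ * v₂ k) {k : ℝ} (hk : k ∈ N)
    (hu' : AntitoneOn (fun c => pd1 u c k) (Ioi 0))
    (hU' : AntitoneOn (fun c => pd1 U c k) (Ioi 0)) :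
    (∀ c > (0:ℝ),
      Pval u U (fun t => Real.exp (-δ₁ * t)) (fun t => Real.exp (-δ₂ * t)) σ K R k c ≤
      Pval u U (fun t => Real.exp (-δ₁ * t)) (fun t => Real.exp (-δ₂ * t)) σ K R k (σ k)) ↔
    pd1 u (σ k) k + pd1 U (σ k) k = deriv v₁ k + deriv v₂ k := by
  have hk0 : 0 < k := hN0 hk
  have hs := hpos k hk
  simp only [Pval_eq hF hN0 hu hU hσ hpos hδ₁ hδ₂ hv₁ hv₂ hode₁ hode₂ hk]
  have hG : ∀ c > (0:ℝ), HasDerivAt (fun c => u c k + U c k) (pd1 u c k + pd1 U c k) c :=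
    fun c hc => (hasDerivAt_pd1 hu hc hk0).add (hasDerivAt_pd1 hU hc hk0)
  constructor
  · intro hmax
    set I := deriv v₁ k + deriv v₂ k
    have hd : HasDerivAt (fun c => u c k + U c k - I * c)
        (pd1 u (σ k) k + pd1 U (σ k) k - I * 1) (σ k) :=
      (hG _ hs).sub ((hasDerivAt_id (σ k)).const_mul I)
    have hloc : IsLocalMax (fun c => u c k + U c k - I * c) (σ k) := by
      filter_upwards [Ioi_mem_nhds hs] with c hc
      have := hmax c hc
      linarith
    linarith [hloc.hasDerivAt_eq_zero hd]
  · intro hfoc c hc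
    have := le_tangent_of_antitoneOn_deriv hG (hu'.add hU') hs hc
    simp only [hfoc] at this
    linarith

/-- The biexponential problem reduces to a system of two ODEs:
necessity and sufficiency, in the biexponential case `h(t)=e^{−δ₁t}`, `H(t)=e^{−δ₂t}`,
`Ũ = ((1−λ)/λ)U`. -/
theorem stmt_8
    (f : ℝ → ℝ) (u U : ℝ → ℝ → ℝ) (δ₁ δ₂ lam : ℝ)
    (hδ : δ₂ < δ₁) (hδ₂ : 0 < δ₂) (hlam0 : 0 < lam) (hlam1 : lam < 1)
    (a b : ℝ) (ha : a = (δ₁ + δ₂) / 2) (hb : b = (δ₁ - δ₂) / 2)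
    (hf_conc : ConcaveOn ℝ (Set.Ici 0) f)
    (hf_cont : ContinuousOn f (Set.Ici 0))
    (hf_smooth : ContDiffOn ℝ (⊤ : ℕ∞) f (Set.Ioi 0))
    (hf_inada0 : Tendsto (deriv f) (nhdsWithin 0 (Set.Ioi 0)) atTop)
    (hf_inada1 : ∃ L ≤ (0:ℝ), Tendsto (deriv f) atTop (nhds L))
    (hu_smooth : ContDiffOn ℝ (⊤ : ℕ∞) (fun p : ℝ × ℝ => u p.1 p.2) (Set.Ioi 0 ×ˢ Set.Ioi 0))
    (hU_smooth : ContDiffOn ℝ (⊤ : ℕ∞) (fun p : ℝ × ℝ => U p.1 p.2) (Set.Ioi 0 ×ˢ Set.Ioi 0))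
    (hu_mono : ∀ k > (0:ℝ), StrictMonoOn (fun c => u c k) (Set.Ioi 0))
    (hU_mono : ∀ k > (0:ℝ), StrictMonoOn (fun c => U c k) (Set.Ioi 0))
    (hu11 : ∀ c > (0:ℝ), ∀ k > (0:ℝ), pd11 u c k < 0)
    (hU11 : ∀ c > (0:ℝ), ∀ k > (0:ℝ), pd11 U c k < 0)
    -- the implicit function φ_λ
    (φ : ℝ → ℝ → ℝ)
    (hφ : ∀ k > (0:ℝ), ∀ x > (0:ℝ),
      0 < φ x k ∧ pd1 u (φ x k) k + (1 - lam) / lam * pd1 U (φ x k) k = x) :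
    -- Necessity
    ((∀ N : Set ℝ, IsOpen N → N ⊆ Set.Ioi 0 → ∀ kinf ∈ N,
      ∀ σ : ℝ → ℝ, ∀ K R : ℝ → ℝ → ℝ, ∀ V W : ℝ → ℝ,
      ContDiffOn ℝ 1 σ N → (∀ k ∈ N, 0 < σ k) →
      (∀ k₀ ∈ N, K 0 k₀ = k₀) →
      (∀ k₀ ∈ N, ∀ t : ℝ, 0 ≤ t →
        HasDerivAt (fun s => K s k₀) (f (K t k₀) - σ (K t k₀)) t) →
      (∀ k₀ ∈ N, ∀ t : ℝ, 0 ≤ t → K t k₀ ∈ N) →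
      (∀ k₀ ∈ N, Tendsto (fun t => K t k₀) atTop (nhds kinf)) →
      (∀ k₀ ∈ N, R k₀ 0 = 1) →
      (∀ k₀ ∈ N, ∀ t : ℝ, 0 ≤ t →
        HasDerivAt (R k₀) ((deriv f (K t k₀) - deriv σ (K t k₀)) * R k₀ t) t) →
      -- σ is an equilibrium strategy
      (∀ k ∈ N, ∀ c > (0:ℝ),
        Pval u (fun c' k' => (1 - lam) / lam * U c' k')
          (fun t => Real.exp (-δ₁ * t)) (fun t => Real.exp (-δ₂ * t)) σ K R k c ≤
        Pval u (fun c' k' => (1 - lam) / lam * U c' k')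
          (fun t => Real.exp (-δ₁ * t)) (fun t => Real.exp (-δ₂ * t)) σ K R k (σ k)) →
      -- V and W defined by the integral formulas, assumed differentiable
      (∀ k₀ ∈ N, V k₀ =
        (∫ t in Set.Ioi (0:ℝ), Real.exp (-δ₁ * t) * u (σ (K t k₀)) (K t k₀)) +
        (1 - lam) / lam *
          ∫ t in Set.Ioi (0:ℝ), Real.exp (-δ₂ * t) * U (σ (K t k₀)) (K t k₀)) →
      (∀ k₀ ∈ N, W k₀ =
        (∫ t in Set.Ioi (0:ℝ), Real.exp (-δ₁ * t) * u (σ (K t k₀)) (K t k₀)) -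
        (1 - lam) / lam *
          ∫ t in Set.Ioi (0:ℝ), Real.exp (-δ₂ * t) * U (σ (K t k₀)) (K t k₀)) →
      DifferentiableOn ℝ V N → DifferentiableOn ℝ W N →
      ((∀ k ∈ N, Eq35 f u U φ lam a b V W k ∧ Eq36 f u U φ lam a b V W k) ∧
        BC37 f u U lam δ₁ δ₂ V kinf ∧ BC38 f u U lam δ₁ δ₂ W kinf))
    ∧
    -- Sufficiency
    (∀ N : Set ℝ, IsOpen N → N ⊆ Set.Ioi 0 → ∀ kinf ∈ N,
      ∀ V W σ : ℝ → ℝ,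
      ContDiffOn ℝ 2 V N → ContDiffOn ℝ 1 W N → (∀ k ∈ N, 0 < deriv V k) →
      (∀ k ∈ N, Eq35 f u U φ lam a b V W k ∧ Eq36 f u U φ lam a b V W k) →
      BC37 f u U lam δ₁ δ₂ V kinf → BC38 f u U lam δ₁ δ₂ W kinf →
      (∀ k ∈ N, σ k = φ (deriv V k) k) → ContDiffOn ℝ 1 σ N →
      ∀ K R : ℝ → ℝ → ℝ,
      (∀ k₀ ∈ N, K 0 k₀ = k₀) →
      (∀ k₀ ∈ N, ∀ t : ℝ, 0 ≤ t →
        HasDerivAt (fun s => K s k₀) (f (K t k₀) - σ (K t k₀)) t) →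
      (∀ k₀ ∈ N, ∀ t : ℝ, 0 ≤ t → K t k₀ ∈ N) →
      (∀ k₀ ∈ N, Tendsto (fun t => K t k₀) atTop (nhds kinf)) →
      (∀ k₀ ∈ N, R k₀ 0 = 1) →
      (∀ k₀ ∈ N, ∀ t : ℝ, 0 ≤ t →
        HasDerivAt (R k₀) ((deriv f (K t k₀) - deriv σ (K t k₀)) * R k₀ t) t) →
      -- conclusion: σ is an equilibrium strategy
      ∀ k ∈ N, ∀ c > (0:ℝ),
        Pval u (fun c' k' => (1 - lam) / lam * U c' k')
          (fun t => Real.exp (-δ₁ * t)) (fun t => Real.exp (-δ₂ * t)) σ K R k c ≤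
        Pval u (fun c' k' => (1 - lam) / lam * U c' k')
          (fun t => Real.exp (-δ₁ * t)) (fun t => Real.exp (-δ₂ * t)) σ K R k (σ k))) := by
  have hδ₁ : 0 < δ₁ := hδ₂.trans hδ
  set κ : ℝ := (1 - lam) / lam with hκ
  have hκ0 : 0 < κ := div_pos (by linarith) hlam0
  have hle : (1 : WithTop ℕ∞) ≤ ((⊤ : ℕ∞) : WithTop ℕ∞) := by exact_mod_cast le_top
  have hu1 := hu_smooth.of_le hle
  have hU1 : ContDiffOn ℝ 1 (fun p : ℝ × ℝ => κ * U p.1 p.2) (Ioi 0 ×ˢ Ioi 0) :=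
    contDiffOn_const.mul (hU_smooth.of_le hle)
  have hua : ∀ k > (0:ℝ), StrictAntiOn (fun c => pd1 u c k) (Ioi 0) := fun k hk =>
    strictAntiOn_pd1 fun c hc => hu11 c hc k hk
  have hUa : ∀ k > (0:ℝ), StrictAntiOn (fun c => pd1 (fun c' k' => κ * U c' k') c k) (Ioi 0) :=
    fun k hk => strictAntiOn_pd1 fun c hc => by
      rw [pd11_const_mul]
      exact mul_neg_of_pos_of_neg hκ0 (hU11 c hc k hk)
  have hflow : ∀ N : Set ℝ, IsOpen N → N ⊆ Ioi 0 → ∀ kinf ∈ N, ∀ σ : ℝ → ℝ,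
      ∀ K R : ℝ → ℝ → ℝ, ContDiffOn ℝ 1 σ N →
      (∀ k₀ ∈ N, K 0 k₀ = k₀) →
      (∀ k₀ ∈ N, ∀ t : ℝ, 0 ≤ t →
        HasDerivAt (fun s => K s k₀) (f (K t k₀) - σ (K t k₀)) t) →
      (∀ k₀ ∈ N, ∀ t : ℝ, 0 ≤ t → K t k₀ ∈ N) →
      (∀ k₀ ∈ N, Tendsto (fun t => K t k₀) atTop (nhds kinf)) →
      (∀ k₀ ∈ N, R k₀ 0 = 1) →
      (∀ k₀ ∈ N, ∀ t : ℝ, 0 ≤ t →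
        HasDerivAt (R k₀) ((deriv f (K t k₀) - deriv σ (K t k₀)) * R k₀ t) t) →
      IsConvergentFlow N kinf (fun k => f k - σ k) K R := by
    intro N hN hN0 kinf hkinf σ K R hσ hK0 hK hKN hKlim hR0 hR
    have hf1 : ContDiffOn ℝ 1 f N := (hf_smooth.of_le hle).mono hN0
    refine ⟨hN, hkinf, hf1.sub hσ, hK0, hK, hKN, hKlim, hR0, fun k hk t ht => ?_⟩
    have hd : ∀ {w : ℝ → ℝ}, ContDiffOn ℝ 1 w N → DifferentiableAt ℝ w (K t k) := fun hw =>
      (hw.differentiableOn one_ne_zero).differentiableAt (hN.mem_nhds (hKN k hk t ht))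
    rw [deriv_fun_sub (hd hf1) (hd hσ)]
    exact hR k hk t ht
  have hderiv : ∀ N : Set ℝ, IsOpen N → ∀ V W : ℝ → ℝ, DifferentiableOn ℝ V N →
      DifferentiableOn ℝ W N → ∀ k ∈ N,
      deriv (fun k => (V k + W k) / 2) k = (deriv V k + deriv W k) / 2 ∧
      deriv (fun k => (V k - W k) / 2) k = (deriv V k - deriv W k) / 2 := by
    intro N hN V W hV hW k hk
    have hVk := (hV.differentiableAt (hN.mem_nhds hk)).hasDerivAt
    have hWk := (hW.differentiableAt (hN.mem_nhds hk)).hasDerivAt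
    exact ⟨((hVk.add hWk).div_const 2).deriv, ((hVk.sub hWk).div_const 2).deriv⟩
  constructor
  · intro N hN hN0 kinf hkinf σ K R V W hσ hpos hK0 hK hKN hKlim hR0 hR heq hV hW hVd hWd
    have hF := hflow N hN hN0 kinf hkinf σ K R hσ hK0 hK hKN hKlim hR0 hR
    have hv₁d : DifferentiableOn ℝ (fun k => (V k + W k) / 2) N := (hVd.add hWd).div_const 2
    have hv₂d : DifferentiableOn ℝ (fun k => (V k - W k) / 2) N := (hVd.sub hWd).div_const 2
    have hode₁ : ∀ k ∈ N, (f k - σ k) * deriv (fun k => (V k + W k) / 2) k + u (σ k) k =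
        δ₁ * ((V k + W k) / 2) := fun k hk =>
      hF.transport_eq_of_integral (q := fun k => u (σ k) k) hδ₁
        (contDiffOn_along hu1 hN0 hσ hpos).continuousOn hv₁d
        (fun k hk => by rw [hV k hk, hW k hk]; ring) hk
    have hode₂ : ∀ k ∈ N, (f k - σ k) * deriv (fun k => (V k - W k) / 2) k + κ * U (σ k) k =
        δ₂ * ((V k - W k) / 2) := fun k hk =>
      hF.transport_eq_of_integral (q := fun k => κ * U (σ k) k) hδ₂
        (contDiffOn_along (u := fun c k => κ * U c k) hU1 hN0 hσ hpos).continuousOn hv₂d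
        (fun k hk => by
          rw [hV k hk, hW k hk]
          simp only [mul_left_comm _ κ, integral_const_mul]
          ring) hk
    have hfoc : ∀ k ∈ N, φ (deriv V k) k = σ k := by
      intro k hk
      have hk0 : 0 < k := hN0 hk
      have h := (forall_Pval_le_iff hF hN0 hu1 hU1 hσ hpos hδ₁ hδ₂ hv₁d hv₂d hode₁ hode₂ hk
        (hua k hk0).antitoneOn (hUa k hk0).antitoneOn).1 (heq k hk)
      obtain ⟨e1, e2⟩ := hderiv N hN V W hVd hWd k hk
      rw [e1, e2, pd1_const_mul] at h
      have hV' : pd1 u (σ k) k + κ * pd1 U (σ k) k = deriv V k := by linarith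
      have hp1 := pd1_pos (hu_mono k hk0) (hua k hk0) (hpos k hk)
      have hp2 := pd1_pos (hU_mono k hk0)
        (strictAntiOn_pd1 fun c hc => hU11 c hc k hk0) (hpos k hk)
      obtain ⟨hφ0, hφ1⟩ := hφ k hk0 (deriv V k) (by rw [← hV']; positivity)
      refine ((hua k hk0).add (hUa k hk0)).injOn hφ0 (hpos k hk) ?_
      simp only [pd1_const_mul]
      rw [hφ1, hV']
    have hg0 : f kinf - σ kinf = 0 := hF.velocity_limit_eq_zero
    have hσinf : σ kinf = f kinf := by linarith
    have b1 := hode₁ kinf hkinf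
    have b2 := hode₂ kinf hkinf
    rw [hg0, zero_mul, zero_add, hσinf] at b1 b2
    have hκδ : (1 - lam) / (lam * δ₂) = κ / δ₂ := by rw [hκ, div_div]
    refine ⟨fun k hk => ?_, ?_, ?_⟩
    · have o1 := hode₁ k hk
      have o2 := hode₂ k hk
      obtain ⟨e1, e2⟩ := hderiv N hN V W hVd hWd k hk
      rw [e1] at o1
      rw [e2] at o2
      rw [Eq35, Eq36, hfoc k hk, ← hκ, ha, hb]
      constructor <;> linarith
    · rw [BC37, hκδ]
      field_simp
      linear_combination (-δ₂) * b1 - δ₁ * b2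
    · rw [BC38, hκδ]
      field_simp
      linear_combination (-δ₂) * b1 + δ₁ * b2
  · intro N hN hN0 kinf hkinf V W σ hV hW hV' heqs _ _ hσφ hσ K R hK0 hK hKN hKlim hR0 hR k hk
    have hF := hflow N hN hN0 kinf hkinf σ K R hσ hK0 hK hKN hKlim hR0 hR
    have hVd := hV.differentiableOn two_ne_zero
    have hWd := hW.differentiableOn one_ne_zero
    have hpos : ∀ k ∈ N, 0 < σ k := fun k hk => by
      rw [hσφ k hk]
      exact (hφ k (hN0 hk) _ (hV' k hk)).1
    have hode₁ : ∀ k ∈ N, (f k - σ k) * deriv (fun k => (V k + W k) / 2) k + u (σ k) k =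
        δ₁ * ((V k + W k) / 2) := fun k hk => by
      obtain ⟨o1, o2⟩ := heqs k hk
      rw [Eq35, ← hσφ k hk, ha, hb, ← hκ] at o1
      rw [Eq36, ← hσφ k hk, ha, hb, ← hκ] at o2
      rw [(hderiv N hN V W hVd hWd k hk).1]
      linarith
    have hode₂ : ∀ k ∈ N, (f k - σ k) * deriv (fun k => (V k - W k) / 2) k + κ * U (σ k) k =
        δ₂ * ((V k - W k) / 2) := fun k hk => by
      obtain ⟨o1, o2⟩ := heqs k hk
      rw [Eq35, ← hσφ k hk, ha, hb, ← hκ] at o1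
      rw [Eq36, ← hσφ k hk, ha, hb, ← hκ] at o2
      rw [(hderiv N hN V W hVd hWd k hk).2]
      linarith
    have hk0 : 0 < k := hN0 hk
    refine (forall_Pval_le_iff hF hN0 hu1 hU1 hσ hpos hδ₁ hδ₂ ((hVd.add hWd).div_const 2)
      ((hVd.sub hWd).div_const 2) hode₁ hode₂ hk
      (hua k hk0).antitoneOn (hUa k hk0).antitoneOn).2 ?_
    obtain ⟨e1, e2⟩ := hderiv N hN V W hVd hWd k hk
    rw [pd1_const_mul, hσφ k hk, (hφ k hk0 _ (hV' k hk)).2]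
    linear_combination -(e1 + e2)
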